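/- arXiv:math/0211032 — 9 statements merged into one kernel-verified Lean document; each statement's English description precedes it below -/
import Mathlib

section
/- Let g be an element of SL(2,ℝ) acting on the upper half-plane ℍ by Möbius transformations. If g fixes two distinct points of ℍ (i.e. there exist z ≠ w in ℍ with g•z = z and g•w = w), then g acts trivially on ℍ: g•u = u for every u ∈ ℍ. -/
open UpperHalfPlane

lemma aux_fixed_iff (g : Matrix.SpecialLinearGroup (Fin 2) ℝ) (u : UpperHalfPlane) :
    g • u = u ↔ (g 0 0 - g 1 1 = 2 * g 1 0 * u.re ∧
      g 0 1 = - (g 1 0 * (u.re ^ 2 + u.im ^ 2))) := by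
  have hc := UpperHalfPlane.coe_specialLinearGroup_apply g u
  simp only [Algebra.algebraMap_self, RingHom.id_apply] at hc
  have hd : ((g 1 0 : ℝ) : ℂ) * u + ((g 1 1 : ℝ) : ℂ) ≠ 0 := by
    intro h
    rw [h, div_zero] at hc
    exact UpperHalfPlane.ne_zero _ hc
  have hy : u.im ≠ 0 := u.im_pos.ne'
  rw [UpperHalfPlane.ext_iff, hc, div_eq_iff hd, Complex.ext_iff]
  simp only [Complex.add_re, Complex.mul_re, Complex.add_im, Complex.mul_im, Complex.ofReal_re,
    Complex.ofReal_im, UpperHalfPlane.coe_re, UpperHalfPlane.coe_im]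
  constructor
  · rintro ⟨h1, h2⟩
    have h3 : g 0 0 - g 1 1 = 2 * g 1 0 * u.re := by
      apply mul_right_cancel₀ hy
      linear_combination h2
    exact ⟨h3, by linear_combination h1 - u.re * h3⟩
  · rintro ⟨h1, h2⟩
    exact ⟨by linear_combination h2 + u.re * h1, by linear_combination u.im * h1⟩

theorem SL2_smul_eq_self_of_two_fixed_points
    (g : Matrix.SpecialLinearGroup (Fin 2) ℝ) (z w : UpperHalfPlane) (hzw : z ≠ w)
    (hz : g • z = z) (hw : g • w = w) :
    ∀ u : UpperHalfPlane, g • u = u := by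
  intro u
  rw [aux_fixed_iff] at *
  obtain ⟨h1, h2⟩ := hz
  obtain ⟨h3, h4⟩ := hw
  have hc : g 1 0 = 0 := by
    by_contra hc
    apply hzw
    have hx : z.re = w.re := by
      apply mul_left_cancel₀ hc
      linear_combination (h3 - h1) / 2
    have hs : z.im ^ 2 = w.im ^ 2 := by
      apply mul_left_cancel₀ hc
      rw [hx] at h2
      linear_combination h2 - h4
    have hy : z.im = w.im := (sq_eq_sq₀ z.im_pos.le w.im_pos.le).1 hs
    apply UpperHalfPlane.ext
    exact Complex.ext hx hy
  rw [hc] at h1 h2 ⊢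
  constructor
  · linear_combination h1
  · linear_combination h2
end

section
/- Let f be an affine isometry equivalence of the Euclidean plane EuclideanSpace ℝ (Fin 2) which is orientation preserving, i.e. the determinant of its linear part is positive. If f fixes two distinct points x ≠ y, then f is the identity map. -/
theorem euclidean_isometry_eq_id_of_orientation_preserving_two_fixed_points
    (f : EuclideanSpace ℝ (Fin 2) ≃ᵃⁱ[ℝ] EuclideanSpace ℝ (Fin 2))
    (horient : 0 < LinearMap.det (f.linearIsometryEquiv.toLinearEquiv :
      EuclideanSpace ℝ (Fin 2) →ₗ[ℝ] EuclideanSpace ℝ (Fin 2)))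
    (x y : EuclideanSpace ℝ (Fin 2)) (hxy : x ≠ y) (hx : f x = x) (hy : f y = y) :
    ∀ p : EuclideanSpace ℝ (Fin 2), f p = p := by
  intro p
  haveI : Fact (Module.finrank ℝ (EuclideanSpace ℝ (Fin 2)) = 2) := ⟨by simp⟩
  let o : Orientation ℝ (EuclideanSpace ℝ (Fin 2)) (Fin 2) :=
    (EuclideanSpace.basisFun (Fin 2) ℝ).toBasis.orientation
  have hlin : ∀ q, f.linearIsometryEquiv (q - x) = f q - x := by
    intro q
    have h := f.map_vsub q x
    rw [hx] at h
    simpa using h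
  have hv : f.linearIsometryEquiv (y - x) = y - x := by rw [hlin, hy]
  have hk := o.kahler_comp_linearIsometryEquiv f.linearIsometryEquiv horient (y - x) (p - x)
  rw [hv, hlin, ← sub_eq_zero, ← map_sub, o.kahler_eq_zero_iff] at hk
  rcases hk with h | h
  · exact absurd (sub_eq_zero.mp h).symm hxy
  · rw [sub_sub_sub_cancel_right] at h
    exact sub_eq_zero.mp h
end

section
/- Let m be a prime number and let N : ℕ → ℕ satisfy N(n) = N(gcd(n,m)) for all n ≥ 1. Then for every real z with |z| < 1, exp(∑_{n=1}^∞ N(n)·zⁿ/n) = (1 − z)^{−N(1)} · (1 − z^m)^{(N(1) − N(m))/m}, where the powers are real powers. -/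
theorem zeta_of_periodic_sequence_prime_period
    (m : ℕ) (hm : m.Prime) (N : ℕ → ℕ) (hN : ∀ n, 1 ≤ n → N n = N (Nat.gcd n m)) :
    ∀ z : ℝ, |z| < 1 →
      Real.exp (∑' n : ℕ, (N (n + 1) : ℝ) * z ^ (n + 1) / (n + 1)) =
        (1 - z) ^ (-(N 1 : ℝ)) * (1 - z ^ m) ^ (((N 1 : ℝ) - (N m : ℝ)) / (m : ℝ)) := by
  intro z hz
  have hm0 : 0 < m := hm.pos
  have hmR : (m : ℝ) ≠ 0 := by exact_mod_cast hm0.ne'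
  have hzm : |z ^ m| < 1 := by
    rw [abs_pow]
    exact pow_lt_one₀ (abs_nonneg z) hz hm0.ne'
  have h1 := Real.hasSum_pow_div_log_of_abs_lt_one hz
  have h2 := Real.hasSum_pow_div_log_of_abs_lt_one hzm
  have hsucc : ∀ k : ℕ, m * (k + 1) - 1 + 1 = m * (k + 1) := fun k =>
    Nat.sub_add_cancel (Nat.mul_pos hm0 (Nat.succ_pos k))
  have hinj : Function.Injective (fun k : ℕ => m * (k + 1) - 1) := by
    intro a b hab
    have h : m * (a + 1) = m * (b + 1) := by
      rw [← hsucc a, ← hsucc b]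
      exact congrArg (· + 1) hab
    have := Nat.eq_of_mul_eq_mul_left hm0 h
    omega
  have h3 : HasSum (fun n : ℕ => if m ∣ n + 1 then z ^ (n + 1) / ((n : ℝ) + 1) else 0)
      ((1 / (m : ℝ)) * -Real.log (1 - z ^ m)) := by
    rw [← hinj.hasSum_iff]
    · refine Eq.mp (congrArg (fun f : ℕ → ℝ => HasSum f _) (Eq.symm ?_)) (h2.mul_left (1 / (m : ℝ)))
      funext k
      have hc : (((m * (k + 1) - 1 : ℕ) : ℝ) + 1) = (m : ℝ) * (k + 1) := by
        exact_mod_cast hsucc k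
      have hk : (k : ℝ) + 1 ≠ 0 := by positivity
      simp only [Function.comp, hc, hsucc, dvd_mul_right, if_true, pow_mul]
      field_simp
    · intro n hn
      rw [if_neg]
      rintro ⟨c, hc⟩
      apply hn
      rcases c with _ | c
      · simp at hc
      · exact ⟨c, by simp only [← hc]; omega⟩
  have h4 := (h1.mul_left (N 1 : ℝ)).add (h3.mul_left ((N m : ℝ) - N 1))
  have h5 : (∑' n : ℕ, (N (n + 1) : ℝ) * z ^ (n + 1) / (n + 1)) =
      (N 1 : ℝ) * -Real.log (1 - z) +
        ((N m : ℝ) - N 1) * ((1 / (m : ℝ)) * -Real.log (1 - z ^ m)) := by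
    rw [← h4.tsum_eq]
    congr 1
    funext n
    rw [hN (n + 1) (by omega)]
    by_cases hd : m ∣ n + 1
    · rw [Nat.gcd_eq_right hd, if_pos hd]
      ring
    · have : Nat.gcd (n + 1) m = 1 := ((hm.coprime_iff_not_dvd).2 hd).symm
      rw [this, if_neg hd]
      ring
  have p1 : 0 < 1 - z := by linarith [(abs_lt.1 hz).2]
  have p2 : 0 < 1 - z ^ m := by linarith [(abs_lt.1 hzm).2]
  rw [h5, Real.rpow_def_of_pos p1, Real.rpow_def_of_pos p2, ← Real.exp_add]
  congr 1
  ring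
end

section
/- Let A be a 2×2 integer matrix with det(I − A) ≠ 0, and let f_A : T → T be the induced map of the 2-torus. Then the set of fixed points of f_A is finite and its cardinality equals |det(I − A)|: Nat.card {x ∈ T : f_A(x) = x} = (det(1 − A)).natAbs. -/
/-- The self-map of the 2-torus `ℝ²/ℤ²` induced by an integer 2×2 matrix `A`:
`(x_i) ↦ (∑_j A i j • x_j)`. -/
noncomputable def torusMatMap (A : Matrix (Fin 2) (Fin 2) ℤ) :
    (Fin 2 → AddCircle (1 : ℝ)) → (Fin 2 → AddCircle (1 : ℝ)) :=
  fun x i => ∑ j, A i j • x j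

/-- The map `ℤ² → T`, `n ↦ [B⁻¹ n]`. -/
noncomputable def torusAux (B : Matrix (Fin 2) (Fin 2) ℤ) :
    (Fin 2 → ℤ) →ₗ[ℤ] (Fin 2 → AddCircle (1 : ℝ)) :=
  AddMonoidHom.toIntLinearMap
    { toFun := fun n i =>
        ((((B.map (Int.cast : ℤ → ℝ))⁻¹.mulVec (fun j => (n j : ℝ))) i : ℝ) : AddCircle (1 : ℝ))
      map_zero' := by
        funext i
        simp [Matrix.mulVec, dotProduct]
      map_add' := by
        intro m n
        funext i
        simp only [Pi.add_apply, Int.cast_add]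
        rw [← AddCircle.coe_add, ← Pi.add_apply, ← Matrix.mulVec_add]
        rfl }

theorem torusAux_apply (B : Matrix (Fin 2) (Fin 2) ℤ) (n : Fin 2 → ℤ) (i : Fin 2) :
    torusAux B n i =
      ((((B.map (Int.cast : ℤ → ℝ))⁻¹.mulVec (fun j => (n j : ℝ))) i : ℝ) : AddCircle (1 : ℝ)) :=
  rfl

theorem torus_unit (B : Matrix (Fin 2) (Fin 2) ℤ) (hB : B.det ≠ 0) :
    IsUnit (B.map (Int.cast : ℤ → ℝ)).det := by
  have h : (B.map (Int.cast : ℤ → ℝ)).det = (B.det : ℝ) := by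
    simp [Matrix.det_fin_two]
  rw [h, isUnit_iff_ne_zero]
  exact_mod_cast hB

theorem torus_coe_zero (r : ℝ) : ((r : ℝ) : AddCircle (1 : ℝ)) = 0 ↔ ∃ m : ℤ, (m : ℝ) = r := by
  rw [AddCircle.coe_eq_zero_iff]
  simp

theorem torus_mulVec_cast (B : Matrix (Fin 2) (Fin 2) ℤ) (m : Fin 2 → ℤ) :
    (B.map (Int.cast : ℤ → ℝ)).mulVec (fun j => (m j : ℝ)) = fun i => ((B.mulVec m i : ℤ) : ℝ) := by
  funext i
  simp [Matrix.mulVec, dotProduct]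

theorem torusAux_ker (B : Matrix (Fin 2) (Fin 2) ℤ) (hB : B.det ≠ 0) :
    LinearMap.ker (torusAux B) = LinearMap.range (Matrix.toLin' B) := by
  have hu := torus_unit B hB
  ext n
  rw [LinearMap.mem_ker, LinearMap.mem_range]
  constructor
  · intro h
    have h1 : ∀ i, ∃ m : ℤ, (m : ℝ) =
        ((B.map (Int.cast : ℤ → ℝ))⁻¹.mulVec (fun j => (n j : ℝ))) i := by
      intro i
      rw [← torus_coe_zero, ← torusAux_apply, h]
      rfl
    choose m hm using h1
    refine ⟨m, ?_⟩
    have h2 := torus_mulVec_cast B m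
    rw [funext hm, Matrix.mulVec_mulVec, Matrix.mul_nonsing_inv _ hu, Matrix.one_mulVec] at h2
    funext i
    rw [Matrix.toLin'_apply]
    have h3 := congrFun h2 i
    exact_mod_cast h3.symm
  · rintro ⟨m, rfl⟩
    funext i
    rw [torusAux_apply, Matrix.toLin'_apply, ← torus_mulVec_cast, Matrix.mulVec_mulVec,
      Matrix.nonsing_inv_mul _ hu, Matrix.one_mulVec]
    exact (torus_coe_zero _).2 ⟨m i, rfl⟩

theorem torus_coe_mulVec (B : Matrix (Fin 2) (Fin 2) ℤ) (y : Fin 2 → ℝ) (i : Fin 2) :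
    (((B.map (Int.cast : ℤ → ℝ)).mulVec y i : ℝ) : AddCircle (1 : ℝ)) =
      torusMatMap B (fun j => ((y j : ℝ) : AddCircle (1 : ℝ))) i := by
  simp [Matrix.mulVec, dotProduct, torusMatMap, Fin.sum_univ_two, ← zsmul_eq_mul]

theorem torusAux_range (B : Matrix (Fin 2) (Fin 2) ℤ) (hB : B.det ≠ 0)
    (x : Fin 2 → AddCircle (1 : ℝ)) :
    x ∈ LinearMap.range (torusAux B) ↔ torusMatMap B x = 0 := by
  have hu := torus_unit B hB
  rw [LinearMap.mem_range]
  constructor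
  · rintro ⟨n, rfl⟩
    funext i
    have h := torus_coe_mulVec B ((B.map (Int.cast : ℤ → ℝ))⁻¹.mulVec (fun j => (n j : ℝ))) i
    rw [Matrix.mulVec_mulVec, Matrix.mul_nonsing_inv _ hu, Matrix.one_mulVec] at h
    exact h.symm.trans ((torus_coe_zero _).2 ⟨n i, rfl⟩)
  · intro h
    have h0 : ∀ i, ∃ r : ℝ, (r : AddCircle (1 : ℝ)) = x i := fun i =>
      QuotientAddGroup.mk_surjective (x i)
    choose y hy using h0
    obtain rfl : (fun i => ((y i : ℝ) : AddCircle (1 : ℝ))) = x := funext hy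
    have h1 : ∀ i, ∃ n : ℤ, (n : ℝ) = (B.map (Int.cast : ℤ → ℝ)).mulVec y i := by
      intro i
      rw [← torus_coe_zero, torus_coe_mulVec, h]
      rfl
    choose n hn using h1
    refine ⟨n, ?_⟩
    funext i
    rw [torusAux_apply, funext hn, Matrix.mulVec_mulVec, Matrix.nonsing_inv_mul _ hu,
      Matrix.one_mulVec]

theorem torus_card_quot (B : Matrix (Fin 2) (Fin 2) ℤ) (hB : B.det ≠ 0) :
    Nat.card ((Fin 2 → ℤ) ⧸ LinearMap.range (Matrix.toLin' B)) = B.det.natAbs := by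
  have hinj : Function.Injective (Matrix.toLin' B) := by
    rw [← LinearMap.ker_eq_bot, LinearMap.ker_eq_bot']
    intro m hm
    rw [Matrix.toLin'_apply] at hm
    exact Matrix.eq_zero_of_mulVec_eq_zero hB hm
  rw [← Submodule.natAbs_det_equiv _ (LinearEquiv.ofInjective _ hinj), ← LinearMap.det_toLin' B]
  congr 2

theorem card_fixedPoints_torusMatMap (A : Matrix (Fin 2) (Fin 2) ℤ)
    (hA : (1 - A).det ≠ 0) :
    Nat.card {x : Fin 2 → AddCircle (1 : ℝ) | torusMatMap A x = x} = ((1 - A).det).natAbs := by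
  have hs : {x : Fin 2 → AddCircle (1 : ℝ) | torusMatMap A x = x} =
      (LinearMap.range (torusAux (1 - A)) : Set (Fin 2 → AddCircle (1 : ℝ))) := by
    ext x
    rw [SetLike.mem_coe, torusAux_range _ hA, Set.mem_setOf_eq]
    have h : torusMatMap (1 - A) x = x - torusMatMap A x := by
      funext i
      simp only [torusMatMap, Matrix.sub_apply, sub_smul, Finset.sum_sub_distrib, Pi.sub_apply]
      congr 1
      simp [Matrix.one_apply, ite_smul]
    rw [h, sub_eq_zero, eq_comm]
  rw [hs, ← torus_card_quot _ hA, ← torusAux_ker _ hA]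
  exact (Nat.card_congr (torusAux (1 - A)).quotKerEquivRange.toEquiv).symm
end

section
/- Let A be a 2×2 real matrix with det A = 1 and |trace A| > 2. If trace A > 2, then det(I − Aⁿ) < 0 for every n ≥ 1; if trace A < −2, then (−1)^{n+1}·det(I − Aⁿ) > 0 for every n ≥ 1. Equivalently, |det(I − Aⁿ)| = (−1)^{r + p·n}·det(I − Aⁿ), where r = 1 is the number of eigenvalues of A of modulus greater than one and p is the number of eigenvalues of A less than −1 (so p = 0 when trace A > 2 and p = 1 when trace A < −2). -/
theorem trace_pow_aux (A : Matrix (Fin 2) (Fin 2) ℝ) (hdet : A.det = 1) (ht : 2 < A.trace)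
    (n : ℕ) : 2 ≤ (A ^ n).trace ∧ (A ^ n).trace < (A ^ (n + 1)).trace := by
  induction n with
  | zero => simpa using ht
  | succ n ih =>
    obtain ⟨h1, h2⟩ := ih
    have hrec : (A ^ (n + 1 + 1)).trace = A.trace * (A ^ (n + 1)).trace - (A ^ n).trace := by
      rw [pow_succ, pow_succ]
      generalize A ^ n = B
      rw [Matrix.det_fin_two] at hdet
      simp only [Matrix.trace_fin_two, Matrix.mul_apply, Fin.sum_univ_two]
      linear_combination (-(B 0 0) - B 1 1) * hdet
    refine ⟨by linarith, ?_⟩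
    rw [hrec]
    nlinarith

theorem det_one_sub_aux (B : Matrix (Fin 2) (Fin 2) ℝ) (h : B.det = 1) :
    (1 - B).det = 2 - B.trace := by
  rw [Matrix.det_fin_two] at *
  simp [Matrix.trace_fin_two]
  linear_combination h

theorem sign_det_one_sub_pow_of_hyperbolic (A : Matrix (Fin 2) (Fin 2) ℝ)
    (hdet : A.det = 1) (htr : 2 < |A.trace|) :
    (2 < A.trace → ∀ n : ℕ, 1 ≤ n → (1 - A ^ n).det < 0) ∧
      (A.trace < -2 → ∀ n : ℕ, 1 ≤ n → 0 < (-1 : ℝ) ^ (n + 1) * (1 - A ^ n).det) := by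
  refine ⟨fun ht n hn => ?_, fun ht n hn => ?_⟩
  · obtain ⟨m, rfl⟩ := Nat.exists_eq_add_of_le' hn
    have := trace_pow_aux A hdet ht m
    rw [det_one_sub_aux _ (by rw [Matrix.det_pow, hdet, one_pow])]
    linarith
  · obtain ⟨m, rfl⟩ := Nat.exists_eq_add_of_le' hn
    have h := trace_pow_aux (-A) (by rw [Matrix.det_neg, hdet]; simp)
      (by rw [Matrix.trace_neg]; linarith) m
    have h3 : 2 < ((-A) ^ (m + 1)).trace := by linarith
    rw [det_one_sub_aux _ (by rw [Matrix.det_pow, hdet, one_pow])]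
    rcases Nat.even_or_odd (m + 1) with he | ho
    · rw [he.neg_pow] at h3
      rw [he.add_one.neg_one_pow]
      linarith
    · rw [ho.neg_pow, Matrix.trace_neg] at h3
      rw [ho.add_one.neg_one_pow]
      linarith
end

section
/- Let A be a 2×2 integer matrix with det A = 1 and |trace A| > 2 (a hyperbolic matrix), and let f_A : T → T be the induced map of the 2-torus. Then for every n ≥ 1, the fixed point set of the n-th iterate f_A^[n] is finite of cardinality |det(I − Aⁿ)|: Nat.card {x ∈ T : f_A^[n](x) = x} = (det(1 − Aⁿ)).natAbs. -/
theorem torusMatMap_iter (A : Matrix (Fin 2) (Fin 2) ℤ) (n : ℕ)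
    (x : Fin 2 → AddCircle (1 : ℝ)) :
    (torusMatMap A)^[n] x = torusMatMap (A ^ n) x := by
  induction n with
  | zero =>
    funext i
    fin_cases i <;> simp [torusMatMap]
  | succ k ih =>
    rw [Function.iterate_succ_apply', ih, pow_succ']
    funext i
    simp only [torusMatMap, Matrix.mul_apply, Fin.sum_univ_two, smul_add, add_smul, mul_smul]
    abel

theorem trace_growth (A : Matrix (Fin 2) (Fin 2) ℤ) (hdet : A.det = 1) (htr : 2 < |A.trace|)
    (n : ℕ) : 2 ≤ |(A ^ n).trace| ∧ |(A ^ n).trace| < |(A ^ (n + 1)).trace| := by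
  have hrec : ∀ m : ℕ, (A ^ (m + 2)).trace = A.trace * (A ^ (m + 1)).trace - (A ^ m).trace := by
    intro m
    rw [pow_succ, pow_succ]
    rw [Matrix.det_fin_two] at hdet
    simp only [Matrix.trace_fin_two, Matrix.mul_apply, Fin.sum_univ_two]
    linear_combination (-(A ^ m) 0 0 - (A ^ m) 1 1) * hdet
  induction n with
  | zero =>
    simp only [pow_zero, zero_add, pow_one, Matrix.trace_one, Fintype.card_fin]
    norm_num
    exact htr
  | succ k ih =>
    obtain ⟨h1, h2⟩ := ih
    refine ⟨by linarith, ?_⟩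
    rw [hrec k]
    have h3 := abs_sub_abs_le_abs_sub (A.trace * (A ^ (k + 1)).trace) ((A ^ k).trace)
    rw [abs_mul] at h3
    nlinarith

theorem det_ne (A : Matrix (Fin 2) (Fin 2) ℤ) (hdet : A.det = 1) (htr : 2 < |A.trace|)
    (n : ℕ) (hn : 1 ≤ n) : (1 - A ^ n).det ≠ 0 := by
  obtain ⟨k, rfl⟩ : ∃ k, n = k + 1 := ⟨n - 1, by omega⟩
  have h := trace_growth A hdet htr k
  have hd : (A ^ (k + 1)).det = 1 := by rw [Matrix.det_pow, hdet, one_pow]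
  intro h0
  have h2 : (A ^ (k + 1)).trace = 2 := by
    rw [Matrix.det_fin_two] at hd h0
    simp only [Matrix.sub_apply, Matrix.one_apply_eq, ne_eq, zero_ne_one, one_ne_zero,
      not_false_eq_true, Matrix.one_apply_ne] at h0
    rw [Matrix.trace_fin_two]
    linarith
  rw [h2] at h
  norm_num at h
  linarith [h.1, h.2]

theorem index_range (B : Matrix (Fin 2) (Fin 2) ℤ) (hB : B.det ≠ 0) :
    (LinearMap.range B.mulVecLin).toAddSubgroup.index = B.det.natAbs := by
  have hinj : Function.Injective B.mulVecLin := by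
    rw [injective_iff_map_eq_zero]
    intro v hv
    exact Matrix.eq_zero_of_mulVec_eq_zero hB hv
  have := Submodule.natAbs_det_equiv (LinearMap.range B.mulVecLin)
    (LinearEquiv.ofInjective B.mulVecLin hinj)
  have h2 : ((LinearMap.range B.mulVecLin).subtype ∘ₗ
      AddMonoidHom.toIntLinearMap (LinearEquiv.ofInjective B.mulVecLin hinj : _ →+ _))
      = Matrix.toLin' B := by
    ext v i
    rfl
  rw [h2, LinearMap.det_toLin'] at this
  rw [this]
  rfl

/-- Solutions of `B x = 0` on the torus, parametrised by `ℤ²`. -/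
noncomputable def solHom (B : Matrix (Fin 2) (Fin 2) ℤ) :
    (Fin 2 → ℤ) →+ (Fin 2 → AddCircle (1 : ℝ)) where
  toFun v i := (((B.adjugate.mulVec v i : ℤ) : ℝ) / (B.det : ℝ) : ℝ)
  map_zero' := by
    funext i
    simp
  map_add' v w := by
    funext i
    simp [Matrix.mulVec_add, add_div]

theorem solHom_ker (B : Matrix (Fin 2) (Fin 2) ℤ) (hB : B.det ≠ 0) :
    (solHom B).ker = (LinearMap.range B.mulVecLin).toAddSubgroup := by
  have hB' : (B.det : ℝ) ≠ 0 := by exact_mod_cast hB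
  ext v
  rw [AddMonoidHom.mem_ker]
  simp only [Submodule.mem_toAddSubgroup, LinearMap.mem_range, Matrix.mulVecLin_apply]
  constructor
  · intro h
    have h1 : ∀ i, ∃ m : ℤ, B.adjugate.mulVec v i = m * B.det := by
      intro i
      have hi := congrFun h i
      simp only [solHom, AddMonoidHom.coe_mk, ZeroHom.coe_mk, Pi.zero_apply] at hi
      rw [AddCircle.coe_eq_zero_iff] at hi
      obtain ⟨m, hm⟩ := hi
      refine ⟨m, ?_⟩
      rw [zsmul_eq_mul, mul_one, eq_div_iff hB'] at hm
      exact_mod_cast hm.symm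
    choose w hw using h1
    refine ⟨w, ?_⟩
    have h2 : B.adjugate.mulVec v = B.det • w := by
      funext i
      rw [hw i, Pi.smul_apply, smul_eq_mul, mul_comm]
    have h3 : B.det • v = B.det • B.mulVec w := by
      rw [← Matrix.mulVec_smul, ← h2, Matrix.mulVec_mulVec, Matrix.mul_adjugate,
        Matrix.smul_mulVec, Matrix.one_mulVec]
    exact (smul_right_injective _ hB h3).symm
  · rintro ⟨w, rfl⟩
    funext i
    simp only [solHom, AddMonoidHom.coe_mk, ZeroHom.coe_mk, Pi.zero_apply]
    rw [AddCircle.coe_eq_zero_iff]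
    refine ⟨w i, ?_⟩
    rw [Matrix.mulVec_mulVec, Matrix.adjugate_mul, Matrix.smul_mulVec, Matrix.one_mulVec]
    simp [hB']

theorem solHom_range (B : Matrix (Fin 2) (Fin 2) ℤ) (hB : B.det ≠ 0)
    (x : Fin 2 → AddCircle (1 : ℝ)) :
    x ∈ (solHom B).range ↔ torusMatMap B x = 0 := by
  have hB' : (B.det : ℝ) ≠ 0 := by exact_mod_cast hB
  rw [AddMonoidHom.mem_range]
  constructor
  · rintro ⟨v, rfl⟩
    funext i
    simp only [torusMatMap, solHom, AddMonoidHom.coe_mk, ZeroHom.coe_mk, Pi.zero_apply,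
      Fin.sum_univ_two, ← AddCircle.coe_zsmul, ← AddCircle.coe_add]
    rw [AddCircle.coe_eq_zero_iff]
    refine ⟨v i, ?_⟩
    have h : B.mulVec (B.adjugate.mulVec v) i = B.det * v i := by
      rw [Matrix.mulVec_mulVec, Matrix.mul_adjugate, Matrix.smul_mulVec, Matrix.one_mulVec]
      rfl
    simp only [Matrix.mulVec, dotProduct, Fin.sum_univ_two] at h ⊢
    have h' := congrArg (Int.cast : ℤ → ℝ) h
    push_cast at h'
    simp only [zsmul_eq_mul, mul_one]
    field_simp
    push_cast
    linarith
  · intro h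
    have hx : ∀ i, ∃ y : ℝ, (y : AddCircle (1 : ℝ)) = x i := fun i =>
      QuotientAddGroup.mk_surjective (x i)
    choose y hy using hx
    have h1 : ∀ i, ∃ m : ℤ, (m : ℝ) = B i 0 * y 0 + B i 1 * y 1 := by
      intro i
      have hi := congrFun h i
      simp only [torusMatMap, Pi.zero_apply, Fin.sum_univ_two, ← hy, ← AddCircle.coe_zsmul,
        ← AddCircle.coe_add] at hi
      rw [AddCircle.coe_eq_zero_iff] at hi
      obtain ⟨m, hm⟩ := hi
      refine ⟨m, ?_⟩
      simpa using hm
    choose v hv using h1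
    refine ⟨v, ?_⟩
    funext i
    simp only [solHom, AddMonoidHom.coe_mk, ZeroHom.coe_mk]
    rw [← hy i]
    congr 1
    rw [div_eq_iff hB', Matrix.det_fin_two, Matrix.adjugate_fin_two]
    have h0 := hv 0
    have h1 := hv 1
    fin_cases i
    · simp [Matrix.mulVec, dotProduct, Fin.sum_univ_two, h0, h1]
      ring
    · simp [Matrix.mulVec, dotProduct, Fin.sum_univ_two, h0, h1]
      ring

theorem card_fixedPoints_iterate_torusMatMap_hyperbolic (A : Matrix (Fin 2) (Fin 2) ℤ)
    (hdet : A.det = 1) (htr : 2 < |A.trace|) :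
    ∀ n : ℕ, 1 ≤ n →
      Nat.card {x : Fin 2 → AddCircle (1 : ℝ) | (torusMatMap A)^[n] x = x} =
        ((1 - A ^ n).det).natAbs := by
  intro n hn
  have hB := det_ne A hdet htr n hn
  rw [← index_range _ hB, ← solHom_ker _ hB, AddSubgroup.index_ker]
  have hset : {x : Fin 2 → AddCircle (1 : ℝ) | (torusMatMap A)^[n] x = x}
      = ((solHom (1 - A ^ n)).range : Set (Fin 2 → AddCircle (1 : ℝ))) := by
    ext x
    rw [SetLike.mem_coe, solHom_range _ hB, Set.mem_ofPred_eq, torusMatMap_iter]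
    have hsub : torusMatMap (1 - A ^ n) x = x - torusMatMap (A ^ n) x := by
      have h1 : torusMatMap 1 x = x := by
        have h0 := torusMatMap_iter A 0 x
        rw [pow_zero] at h0
        exact h0.symm
      nth_rewrite 2 [← h1]
      funext i
      simp only [torusMatMap, Pi.sub_apply, Matrix.sub_apply, sub_smul,
        Finset.sum_sub_distrib]
    rw [hsub, sub_eq_zero, eq_comm]
  rw [hset]
  rfl
end

section
/- Let A be a 2×2 integer matrix with det A = 1 and |trace A| > 2 (a hyperbolic matrix), and let f_A : T → T be the induced (continuous) map of the 2-torus. If x ≠ y are two fixed points of f_A, then x and y lie in different fixed point classes: there is no path c from x to y in T such that the path f_A ∘ c is homotopic to c relative to endpoints. -/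
/-- The continuous self-map of the 2-torus `ℝ²/ℤ²` induced by an integer 2×2 matrix `A`:
`(x_i) ↦ (∑_j A i j • x_j)`. -/
noncomputable def torusMatMapC (A : Matrix (Fin 2) (Fin 2) ℤ) :
    C(Fin 2 → AddCircle (1 : ℝ), Fin 2 → AddCircle (1 : ℝ)) :=
  ⟨fun x i => ∑ j, A i j • x j, by
    refine continuous_pi fun i => continuous_finset_sum _ fun j _ => ?_
    exact (continuous_zsmul (A i j)).comp (continuous_apply j)⟩

theorem fixed_points_of_hyperbolic_torus_map_in_distinct_classes
    (A : Matrix (Fin 2) (Fin 2) ℤ) (hdet : A.det = 1) (htr : 2 < |A.trace|)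
    (x y : Fin 2 → AddCircle (1 : ℝ)) (hxy : x ≠ y)
    (hx : torusMatMapC A x = x) (hy : torusMatMapC A y = y) :
    ¬ ∃ c : C(unitInterval, Fin 2 → AddCircle (1 : ℝ)), c 0 = x ∧ c 1 = y ∧
      Nonempty (ContinuousMap.HomotopyRel ((torusMatMapC A).comp c) c {0, 1}) := by
  rintro ⟨c, hc0, hc1, ⟨H⟩⟩
  have cov : IsCoveringMap ((↑) : ℝ → AddCircle (1 : ℝ)) := AddCircle.isCoveringMap_coe 1
  let ev : (i : Fin 2) → C(Fin 2 → AddCircle (1 : ℝ), AddCircle (1 : ℝ)) :=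
    fun i => ⟨fun z => z i, continuous_apply i⟩
  -- lift every coordinate of the path
  have lift : ∀ i, ∃ Γ : C(unitInterval, ℝ), ∀ t, ((Γ t : ℝ) : AddCircle (1 : ℝ)) = c t i := by
    intro i
    obtain ⟨e, he⟩ := QuotientAddGroup.mk_surjective (c 0 i)
    obtain ⟨Γ, h, -⟩ := cov.exists_path_lifts ((ev i).comp c) e he.symm
    exact ⟨Γ, fun t => congrFun h t⟩
  choose Γ hΓ using lift
  let Λ : Fin 2 → C(unitInterval, ℝ) := fun i => ∑ j, A i j • Γ j
  have hΛ' : ∀ i t, Λ i t = ∑ j, (A i j : ℝ) * Γ j t := by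
    intro i t
    simp [Λ]
  have hΛ : ∀ i t, ((Λ i t : ℝ) : AddCircle (1 : ℝ)) = torusMatMapC A (c t) i := by
    intro i t
    simp [Λ, torusMatMapC, ← hΓ]
  have key : ∀ i, Λ i 1 - Λ i 0 = Γ i 1 - Γ i 0 := by
    intro i
    have h0 : ((Λ i 0 : ℝ) : AddCircle (1 : ℝ)) = c 0 i := by
      rw [hΛ, hc0, hx]
    let Γ' : C(unitInterval, ℝ) := Γ i + ContinuousMap.const _ (Λ i 0 - Γ i 0)
    have hΓ' : ∀ t, ((Γ' t : ℝ) : AddCircle (1 : ℝ)) = c t i := by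
      intro t
      simp [Γ', hΓ, h0]
    have g0 : ((ev i).comp ((torusMatMapC A).comp c)) 0 = ((Λ i 0 : ℝ) : AddCircle (1 : ℝ)) :=
      (hΛ i 0).symm
    have g1 : ((ev i).comp c) 0 = ((Λ i 0 : ℝ) : AddCircle (1 : ℝ)) := h0.symm
    have hom : ((ev i).comp ((torusMatMapC A).comp c)).HomotopicRel ((ev i).comp c) {0, 1} :=
      ⟨H.compContinuousMap (ev i)⟩
    have e := cov.liftPath_apply_one_eq_of_homotopicRel hom (Λ i 0) g0 g1
    rw [← (cov.eq_liftPath_iff' (Γ := Λ i) g0).2 ⟨funext fun t => hΛ i t, rfl⟩,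
      ← (cov.eq_liftPath_iff' (Γ := Γ') g1).2 ⟨funext fun t => hΓ' t, by simp [Γ']⟩] at e
    have : Γ' 1 = Γ i 1 + (Λ i 0 - Γ i 0) := rfl
    linarith
  have k0 := key 0
  have k1 := key 1
  simp only [hΛ', Fin.sum_univ_two] at k0 k1
  have hd : (A 0 0 : ℝ) * A 1 1 - A 0 1 * A 1 0 = 1 := by
    rw [Matrix.det_fin_two] at hdet
    exact_mod_cast hdet
  have ht : (2 : ℝ) - (A 0 0 + A 1 1) ≠ 0 := by
    intro h
    have h2 : A.trace = 2 := by
      rw [Matrix.trace_fin_two]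
      have : (A 0 0 : ℝ) + A 1 1 = 2 := by linarith
      exact_mod_cast this
    rw [h2] at htr
    norm_num at htr
  have v0 : Γ 0 1 - Γ 0 0 = 0 := by
    apply (mul_eq_zero.1 _).resolve_left ht
    linear_combination ((A 1 1 : ℝ) - 1) * k0 - (A 0 1 : ℝ) * k1 - (Γ 0 1 - Γ 0 0) * hd
  have v1 : Γ 1 1 - Γ 1 0 = 0 := by
    apply (mul_eq_zero.1 _).resolve_left ht
    linear_combination ((A 0 0 : ℝ) - 1) * k1 - (A 1 0 : ℝ) * k0 - (Γ 1 1 - Γ 1 0) * hd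
  apply hxy
  funext i
  rw [← hc0, ← hc1, ← hΓ, ← hΓ]
  congr 1
  fin_cases i
  · exact (sub_eq_zero.1 v0).symm
  · exact (sub_eq_zero.1 v1).symm
end

section
/- Let (X,d) be a metric space, f : X → X a continuous map, and n ≥ 1. Let δ > 0 and ε > 0 satisfy 2ε < δ and assume: (i) every loop in X of diameter < 2δ is null-homotopic, i.e. for every point a and every path γ from a to a whose image has diameter < 2δ, γ is homotopic relative endpoints to the constant path at a; (ii) d(f(a), f(b)) < δ whenever d(a,b) < 2ε; (iii) any two points a, b with d(a,b) ≤ ε are joined by a path whose image has diameter < 2ε. If x and y are fixed points of f^[n] and d(f^[i](x), f^[i](y)) ≤ ε for all 0 ≤ i < n, then x and y belong to the same fixed point class of f^[n]: there exists a path c from x to y such that f^[n] ∘ c is homotopic to c relative to endpoints. -/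
theorem homotopic_of_trans_symm {X : Type*} [TopologicalSpace X] {a b : X} (p q : Path a b)
    (h : (p.trans q.symm).Homotopic (Path.refl a)) : p.Homotopic q := by
  have h1 : ((p.trans q.symm).trans q).Homotopic ((Path.refl a).trans q) :=
    h.hcomp (Path.Homotopic.refl q)
  have h2 : ((Path.refl a).trans q).Homotopic q := ⟨Path.Homotopy.reflTrans q⟩
  have h3 : ((p.trans q.symm).trans q).Homotopic (p.trans (q.symm.trans q)) :=
    ⟨Path.Homotopy.transAssoc p q.symm q⟩
  have h4 : (p.trans (q.symm.trans q)).Homotopic (p.trans (Path.refl b)) :=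
    (Path.Homotopic.refl p).hcomp (Path.Homotopic.symm ⟨Path.Homotopy.reflSymmTrans q⟩)
  have h5 : (p.trans (Path.refl b)).Homotopic p := ⟨Path.Homotopy.transRefl p⟩
  exact ((h5.symm.trans h4.symm).trans h3.symm).trans (h1.trans h2)

theorem homotopic_of_diam {X : Type*} [MetricSpace X] {δ : ℝ}
    (hloop : ∀ (a : X) (γ : Path a a), Metric.diam (Set.range γ) < 2 * δ →
      Path.Homotopic γ (Path.refl a)) {a b : X} (p q : Path a b)
    (h : Metric.diam (Set.range p) + Metric.diam (Set.range q) < 2 * δ) : p.Homotopic q := by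
  apply homotopic_of_trans_symm
  apply hloop
  rw [Path.trans_range, Path.symm_range]
  refine lt_of_le_of_lt (Metric.diam_union' ⟨a, ?_, ?_⟩) h
  · exact p.source_mem_range
  · exact q.source_mem_range

theorem same_fixed_point_class_of_eps_close_orbit {X : Type*} [MetricSpace X]
    (f : X → X) (hf : Continuous f) (n : ℕ) (hn : 1 ≤ n)
    (δ ε : ℝ) (hδ : 0 < δ) (hε : 0 < ε) (hεδ : 2 * ε < δ)
    (hloop : ∀ (a : X) (γ : Path a a), Metric.diam (Set.range γ) < 2 * δ →
      Path.Homotopic γ (Path.refl a))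
    (hunif : ∀ a b : X, dist a b < 2 * ε → dist (f a) (f b) < δ)
    (hpath : ∀ a b : X, dist a b ≤ ε → ∃ p : Path a b, Metric.diam (Set.range p) < 2 * ε)
    (x y : X) (hx : f^[n] x = x) (hy : f^[n] y = y)
    (hclose : ∀ i, i < n → dist (f^[i] x) (f^[i] y) ≤ ε) :
    ∃ c : Path x y, Path.Homotopic ((c.map (hf.iterate n)).cast hx.symm hy.symm) c := by
  obtain ⟨c, hc⟩ := hpath x y (hclose 0 hn)
  refine ⟨c, ?_⟩
  have key : ∀ m, m ≤ n → ∀ (a b : X) (ha : a = f^[m] x) (hb : b = f^[m] y) (q : Path a b),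
      Metric.diam (Set.range q) < 2 * ε →
      Path.Homotopic ((c.map (hf.iterate m)).cast ha hb) q := by
    intro m
    induction m with
    | zero =>
      intro _ a b ha hb q hq
      apply homotopic_of_diam hloop
      have : Set.range ((c.map (hf.iterate 0)).cast ha hb) = Set.range c := rfl
      rw [this]
      linarith
    | succ m ih =>
      intro hm a b ha hb q hq
      obtain ⟨r, hr⟩ := hpath _ _ (hclose m hm)
      have h1 := (ih (by omega) _ _ rfl rfl r hr).map ⟨f, hf⟩
      have ha' : a = f (f^[m] x) := by rw [ha, Function.iterate_succ_apply']
      have hb' : b = f (f^[m] y) := by rw [hb, Function.iterate_succ_apply']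
      have h2 := h1.pathCast ha' hb'
      have h3 : Path.Homotopic ((r.map hf).cast ha' hb') q := by
        apply homotopic_of_diam hloop
        have : Metric.diam (Set.range ((r.map hf).cast ha' hb')) ≤ δ := by
          apply Metric.diam_le_of_forall_dist_le hδ.le
          rintro _ ⟨s, rfl⟩ _ ⟨t, rfl⟩
          refine (hunif (r s) (r t) (lt_of_le_of_lt ?_ hr)).le
          exact Metric.dist_le_diam_of_mem (isCompact_range r.continuous).isBounded
            ⟨s, rfl⟩ ⟨t, rfl⟩
        linarith
      have h4 := h2.trans h3
      convert h4 using 1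
      ext t
      exact Function.iterate_succ_apply' f m (c t)
  exact key n le_rfl x y hx.symm hy.symm c hc
end

section
/- Let N be a finite set (the alphabet), A : N × N → ℕ a matrix all of whose entries are 0 or 1, and let Ω = {x : ℤ → N | for all k, A(x_k, x_{k+1}) = 1} be the associated subshift of finite type with shift map σ(x)_k = x_{k+1}. Then for every n ≥ 1, the number of fixed points of σⁿ in Ω is the trace of Aⁿ: Nat.card {x : ℤ → N | (for all k, A(x_k, x_{k+1}) = 1) and (for all k, x_{k+n} = x_k)} = trace(Aⁿ). -/
theorem sum_paths_aux {N : Type*} [Fintype N] [DecidableEq N] (A : Matrix N N ℕ) (m : ℕ) :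
    ∀ g : N → N → ℕ, ∑ f : Fin (m + 1) → N,
      g (f 0) (f (Fin.last m)) * ∏ k : Fin m, A (f k.castSucc) (f k.succ) =
      ∑ i, ∑ j, g i j * (A ^ m) i j := by
  induction m with
  | zero =>
    intro g
    rw [← (Equiv.funUnique (Fin 1) N).symm.sum_comp]
    simp [Matrix.one_apply]
  | succ m ih =>
    intro g
    rw [← (Fin.snocEquiv (fun _ : Fin (m + 2) => N)).sum_comp, Fintype.sum_prod_type_right]
    have h := ih (fun i j => ∑ b, g i b * A j b)
    have e : ∀ (f : Fin (m + 1) → N) (b : N),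
        g (Fin.snocEquiv (fun _ : Fin (m + 2) => N) (b, f) 0)
          (Fin.snocEquiv (fun _ : Fin (m + 2) => N) (b, f) (Fin.last (m + 1))) *
        ∏ k : Fin (m + 1), A (Fin.snocEquiv (fun _ : Fin (m + 2) => N) (b, f) k.castSucc)
          (Fin.snocEquiv (fun _ : Fin (m + 2) => N) (b, f) k.succ) =
        (g (f 0) b * A (f (Fin.last m)) b) * ∏ k : Fin m, A (f k.castSucc) (f k.succ) := by
      intro f b
      have h0 : (Fin.snoc f b : Fin (m + 2) → N) 0 = f 0 := by
        rw [← Fin.castSucc_zero, Fin.snoc_castSucc (α := fun _ => N)]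
      have h1 : ∀ k : Fin m, (Fin.snoc f b : Fin (m + 2) → N) k.castSucc.succ = f k.succ := by
        intro k
        rw [Fin.succ_castSucc, Fin.snoc_castSucc (α := fun _ => N)]
      rw [Fin.prod_univ_castSucc]
      simp only [Fin.snocEquiv_apply, Fin.snoc_castSucc (α := fun _ => N),
        Fin.snoc_last (α := fun _ => N), Fin.succ_last, h0, h1]
      ring
    simp only [e, ← Finset.sum_mul]
    rw [h]
    refine Finset.sum_congr rfl fun i _ => ?_
    simp only [pow_succ, Matrix.mul_apply, Finset.sum_mul, Finset.mul_sum]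
    rw [Finset.sum_comm]
    refine Finset.sum_congr rfl fun b _ => Finset.sum_congr rfl fun j _ => ?_
    ring

theorem card_periodic_points_subshift_eq_trace_pow
    (N : Type*) [Fintype N] [DecidableEq N] (A : Matrix N N ℕ)
    (hA : ∀ i j, A i j = 0 ∨ A i j = 1) (n : ℕ) (hn : 1 ≤ n) :
    Nat.card {x : ℤ → N | (∀ k : ℤ, A (x k) (x (k + 1)) = 1) ∧ ∀ k : ℤ, x (k + n) = x k} =
      (A ^ n).trace := by
  obtain ⟨m, rfl⟩ : ∃ m, n = m + 1 := ⟨n - 1, by omega⟩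
  have h := sum_paths_aux A m (fun i j => A j i)
  have ht : (A ^ (m + 1)).trace = ∑ i, ∑ j, A j i * (A ^ m) i j := by
    simp only [Matrix.trace, Matrix.diag, pow_succ, Matrix.mul_apply]
    refine Finset.sum_congr rfl fun i _ => Finset.sum_congr rfl fun j _ => mul_comm _ _
  rw [ht, ← h]
  have hind : ∀ f : Fin (m + 1) → N,
      A (f (Fin.last m)) (f 0) * ∏ k : Fin m, A (f k.castSucc) (f k.succ) =
      if (A (f (Fin.last m)) (f 0) = 1 ∧ ∀ k : Fin m, A (f k.castSucc) (f k.succ) = 1)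
        then 1 else 0 := by
    intro f
    split_ifs with hf
    · simp [hf.1, hf.2]
    · rw [not_and_or] at hf
      rcases hf with hf | hf
      · rw [(hA _ _).resolve_right hf, zero_mul]
      · push Not at hf
        obtain ⟨k, hk⟩ := hf
        rw [Finset.prod_eq_zero (Finset.mem_univ k) ((hA _ _).resolve_right hk), mul_zero]
  simp only [hind]
  rw [Finset.sum_boole, Nat.cast_id, ← Fintype.card_subtype, ← Nat.card_eq_fintype_card]
  -- periodicity reduces indices modulo m + 1
  have hper : ∀ x : ℤ → N, (∀ k : ℤ, x (k + ((m + 1 : ℕ) : ℤ)) = x k) →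
      ∀ k : ℤ, x (k % ((m + 1 : ℕ) : ℤ)) = x k := by
    intro x hx k
    have hp : Function.Periodic x ((m + 1 : ℕ) : ℤ) := hx
    have := hp.int_mul (k / ((m + 1 : ℕ) : ℤ)) (k % ((m + 1 : ℕ) : ℤ))
    rw [← this]
    congr 1
    rw [mul_comm]
    exact Int.emod_add_mul_ediv k _
  have hlt : ∀ k : ℤ, (k % ((m + 1 : ℕ) : ℤ)).toNat < m + 1 := by
    intro k
    have h1 := Int.emod_nonneg k (b := ((m + 1 : ℕ) : ℤ)) (by omega)
    have h2 := Int.emod_lt_of_pos k (b := ((m + 1 : ℕ) : ℤ)) (by omega)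
    omega
  refine Nat.card_congr
    { toFun := fun x => ⟨fun k => x.1 (k : ℕ), ?_, ?_⟩
      invFun := fun f => ⟨fun k => f.1 ⟨(k % ((m + 1 : ℕ) : ℤ)).toNat, hlt k⟩, ?_, ?_⟩
      left_inv := ?_
      right_inv := ?_ }
  · have h1 := x.2.1 m
    have h2 := x.2.2 0
    have h3 : x.1 ((m : ℤ) + 1) = x.1 0 := by
      rw [← h2]
      congr 1
      push_cast
      ring
    rw [h3] at h1
    exact h1
  · intro k
    have h1 := x.2.1 (k : ℕ)
    simpa using h1
  · intro k
    have h1 := Int.emod_nonneg k (b := ((m + 1 : ℕ) : ℤ)) (by omega)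
    have h2 := Int.emod_lt_of_pos k (b := ((m + 1 : ℕ) : ℤ)) (by omega)
    have h3 : (k + 1) % ((m + 1 : ℕ) : ℤ) = (k % ((m + 1 : ℕ) : ℤ) + 1) % ((m + 1 : ℕ) : ℤ) := by
      simp
    generalize hr : k % ((m + 1 : ℕ) : ℤ) = r at h1 h2 h3
    by_cases hrm : r = m
    · have e0 : (k + 1) % ((m + 1 : ℕ) : ℤ) = 0 := by
        rw [h3, hrm]; push_cast; simp
      have i1 : (⟨(k % ((m + 1 : ℕ) : ℤ)).toNat, hlt k⟩ : Fin (m + 1)) = Fin.last m := by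
        apply Fin.ext
        show (k % ((m + 1 : ℕ) : ℤ)).toNat = m
        rw [hr]; omega
      have i2 : (⟨((k + 1) % ((m + 1 : ℕ) : ℤ)).toNat, hlt (k + 1)⟩ : Fin (m + 1)) = 0 := by
        apply Fin.ext
        show ((k + 1) % ((m + 1 : ℕ) : ℤ)).toNat = 0
        rw [e0]; rfl
      beta_reduce
      rw [i1, i2]
      exact f.2.1
    · have e1 : (k + 1) % ((m + 1 : ℕ) : ℤ) = r + 1 := by
        rw [h3, Int.emod_eq_of_lt (by omega) (by omega)]
      have hrl : r.toNat < m := by omega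
      have i1 : (⟨(k % ((m + 1 : ℕ) : ℤ)).toNat, hlt k⟩ : Fin (m + 1)) =
          Fin.castSucc ⟨r.toNat, hrl⟩ := by
        apply Fin.ext
        show (k % ((m + 1 : ℕ) : ℤ)).toNat = r.toNat
        rw [hr]
      have i2 : (⟨((k + 1) % ((m + 1 : ℕ) : ℤ)).toNat, hlt (k + 1)⟩ : Fin (m + 1)) =
          Fin.succ ⟨r.toNat, hrl⟩ := by
        apply Fin.ext
        show ((k + 1) % ((m + 1 : ℕ) : ℤ)).toNat = r.toNat + 1
        rw [e1]; omega
      beta_reduce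
      rw [i1, i2]
      exact f.2.2 ⟨r.toNat, hrl⟩
  · intro k
    simp only [Int.add_emod_right]
  · intro x
    ext k
    have h1 := Int.emod_nonneg k (b := ((m + 1 : ℕ) : ℤ)) (by omega)
    simp only [Int.toNat_of_nonneg h1]
    exact hper x.1 x.2.2 k
  · intro f
    ext k
    have h1 : ((k : ℕ) : ℤ) % ((m + 1 : ℕ) : ℤ) = (k : ℕ) :=
      Int.emod_eq_of_lt (by omega) (by omega)
    simp only [h1, Int.toNat_natCast]
end
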